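/- arXiv:2005.02800 — 2 statements merged into one kernel-verified Lean document; each statement's English description precedes it below -/
import Mathlib

section
/- There exists a constant C₁ > 0 such that for all z ≠ 0, f₁(z) ≤ (C₁/|z|)·(1 + log(1+z²))^{-(1+γ)}. -/
open MeasureTheory Real Filter Set

/-- Normal density with mean `0` and variance `u`. -/
noncomputable def normPdf (z u : ℝ) : ℝ :=
  (Real.sqrt (2 * Real.pi * u))⁻¹ * Real.exp (-(z ^ 2) / (2 * u))

/-- Density of the `H`-distribution with parameter `γ`. -/
noncomputable def Hdens (γ u : ℝ) : ℝ :=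
  γ / ((1 + u) * (1 + Real.log (1 + u)) ^ (1 + γ))

/-- `f₁(z) = ∫₀^∞ φ(z;0,u) H(u;γ) du`, the scale mixture of normals by the
`H`-distribution. -/
noncomputable def f1 (γ z : ℝ) : ℝ :=
  ∫ u in Set.Ioi (0:ℝ), normPdf z u * Hdens γ u

/-- Polynomial growth is dominated by the exponential `exp (w / 4)`. -/
lemma one_add_rpow_le_mul_exp {p w : ℝ} (hp : 0 < p) (hw : 0 ≤ w) :
    (1 + w) ^ p ≤ (4 * p) ^ p * exp (1 / 4) * exp (w / 4) := by
  have h : 1 + w ≤ 4 * p * exp ((1 + w) / (4 * p)) := by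
    have h1 := add_one_le_exp ((1 + w) / (4 * p))
    calc 1 + w = 4 * p * ((1 + w) / (4 * p)) := by field_simp
      _ ≤ _ := by gcongr; linarith
  calc (1 + w) ^ p ≤ (4 * p * exp ((1 + w) / (4 * p))) ^ p := by gcongr
    _ = (4 * p) ^ p * exp ((1 + w) / 4) := by
      rw [mul_rpow (by positivity) (by positivity), ← exp_mul]
      congr 2
      field_simp
    _ = _ := by rw [mul_assoc, ← exp_add]; ring_nf

/-- Submultiplicativity of `u ↦ 1 + log (1 + u)` on the positive reals. -/
lemma one_add_log_one_add_le_mul {s u : ℝ} (hs : 0 ≤ s) (hu : 0 < u) :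
    1 + log (1 + s) ≤ (1 + log (1 + u)) * (1 + log (1 + s / u)) := by
  have hw : 0 ≤ s / u := by positivity
  have h1 : log (1 + s) ≤ log (1 + u) + log (1 + s / u) := by
    rw [← log_mul (by positivity) (by positivity)]
    apply log_le_log (by positivity)
    have : (1 + u) * (1 + s / u) = 1 + s + u + s / u := by field_simp; ring
    linarith
  have h2 : 0 ≤ log (1 + u) := log_nonneg (by linarith)
  have h3 : 0 ≤ log (1 + s / u) := log_nonneg (by linarith)
  nlinarith [mul_nonneg h2 h3]

lemma integrableOn_rpow_mul_exp_neg_inv :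
    IntegrableOn (fun v : ℝ => v ^ (-(3 / 2) : ℝ) * exp (-(1 / (4 * v)))) (Ioi 0) := by
  have h : IntegrableOn (fun w : ℝ => w ^ (-(1 / 2) : ℝ) * exp (-(1 / 4) * w ^ (1 : ℝ)))
      (Ioi 0) :=
    integrableOn_rpow_mul_exp_neg_mul_rpow (by norm_num) (by norm_num) (by norm_num)
  rw [← integrableOn_Ioi_comp_rpow_iff _ (show (-1 : ℝ) ≠ 0 by norm_num)] at h
  refine h.congr_fun (fun v hv => ?_) measurableSet_Ioi
  have hv : 0 < v := hv
  simp only [smul_eq_mul, rpow_one]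
  rw [← rpow_mul hv.le, abs_neg, abs_one, one_mul, ← mul_assoc, ← rpow_add hv, rpow_neg_one]
  norm_num
  left
  ring

lemma normPdf_mul_Hdens_nonneg {γ u : ℝ} (z : ℝ) (hγ : 0 < γ) (hu : 0 < u) :
    0 ≤ normPdf z u * Hdens γ u := by
  have : 0 ≤ log (1 + u) := log_nonneg (by linarith)
  unfold normPdf Hdens
  positivity

lemma normPdf_mul_Hdens_le {γ z u : ℝ} (hγ : 0 < γ) (hz : z ≠ 0) (hu : 0 < u) :
    normPdf z u * Hdens γ u ≤
      γ * ((4 * (1 + γ)) ^ (1 + γ) * exp (1 / 4)) * (1 + log (1 + z ^ 2)) ^ (-(1 + γ)) *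
        (|z| ^ 3)⁻¹ * (((z ^ 2)⁻¹ * u) ^ (-(3 / 2) : ℝ) * exp (-(1 / (4 * ((z ^ 2)⁻¹ * u))))) := by
  have hz2 : 0 < z ^ 2 := by positivity
  have ha : 0 < |z| := abs_pos.mpr hz
  have hu0 : 0 ≤ log (1 + u) := log_nonneg (by linarith)
  have hs0 : 0 ≤ log (1 + z ^ 2) := log_nonneg (by linarith)
  have hw : 0 < z ^ 2 / u := by positivity
  have hw0 : 0 ≤ log (1 + z ^ 2 / u) := log_nonneg (by linarith)
  have hL : (1 + log (1 + u)) ^ (-(1 + γ)) ≤ (1 + log (1 + z ^ 2)) ^ (-(1 + γ)) *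
      ((4 * (1 + γ)) ^ (1 + γ) * exp (1 / 4) * exp (z ^ 2 / u / 4)) := by
    have h1 : (1 + log (1 + z ^ 2)) ^ (1 + γ) ≤
        (1 + log (1 + u)) ^ (1 + γ) * (1 + log (1 + z ^ 2 / u)) ^ (1 + γ) := by
      rw [← mul_rpow (by positivity) (by positivity)]
      gcongr
      exact one_add_log_one_add_le_mul hz2.le hu
    have h2 : (1 + log (1 + z ^ 2 / u)) ^ (1 + γ) ≤
        (4 * (1 + γ)) ^ (1 + γ) * exp (1 / 4) * exp (z ^ 2 / u / 4) := by
      refine le_trans ?_ (one_add_rpow_le_mul_exp (by positivity) hw.le)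
      gcongr
      have := log_le_sub_one_of_pos (show 0 < 1 + z ^ 2 / u by positivity)
      linarith
    rw [rpow_neg (by positivity), rpow_neg (by positivity), inv_mul_eq_div,
      le_div_iff₀ (by positivity), inv_mul_le_iff₀ (by positivity)]
    exact h1.trans (by gcongr)
  have hscale : (|z| ^ 3)⁻¹ * ((z ^ 2)⁻¹ * u) ^ (-(3 / 2) : ℝ) = (√u)⁻¹ * u⁻¹ := by
    have h1 : ((z ^ 2)⁻¹) ^ (-(3 / 2) : ℝ) = |z| ^ 3 := by
      rw [rpow_neg (by positivity), inv_rpow (by positivity), inv_inv, ← sq_abs,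
        ← rpow_natCast, ← rpow_mul ha.le, ← rpow_natCast]
      norm_num
    rw [mul_rpow (by positivity) hu.le, h1, sqrt_eq_rpow, ← rpow_neg hu.le, ← rpow_neg_one u,
      ← rpow_add hu, inv_mul_cancel_left₀ (by positivity)]
    norm_num
  have hexp : exp (-(1 / (4 * ((z ^ 2)⁻¹ * u)))) =
      exp (z ^ 2 / u / 4) * exp (-(z ^ 2) / (2 * u)) := by
    rw [← exp_add]
    congr 1
    field_simp
    ring
  have hsqrt : (√(2 * π * u))⁻¹ ≤ (√u)⁻¹ := by
    gcongr
    nlinarith [pi_gt_three]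
  have hinv : (1 + u)⁻¹ ≤ u⁻¹ := by
    gcongr
    linarith
  calc normPdf z u * Hdens γ u
      = γ * (1 + log (1 + u)) ^ (-(1 + γ)) * ((√(2 * π * u))⁻¹ * (1 + u)⁻¹) *
          exp (-(z ^ 2) / (2 * u)) := by
        unfold normPdf Hdens
        rw [rpow_neg (by positivity), div_eq_mul_inv γ, mul_inv (1 + u)]
        ring
    _ ≤ γ * ((1 + log (1 + z ^ 2)) ^ (-(1 + γ)) *
          ((4 * (1 + γ)) ^ (1 + γ) * exp (1 / 4) * exp (z ^ 2 / u / 4))) * ((√u)⁻¹ * u⁻¹) *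
          exp (-(z ^ 2) / (2 * u)) := by gcongr
    _ = _ := by rw [← hscale, hexp]; ring

/-- There is `C₁ > 0` such that for all `z ≠ 0`,
`f₁(z) ≤ (C₁/|z|)·(1+log(1+z²))^{-(1+γ)}`. -/
theorem f1_upper_bound (γ : ℝ) (hγ : 0 < γ) :
    ∃ C₁ > (0:ℝ), ∀ z : ℝ, z ≠ 0 →
      f1 γ z ≤ C₁ / |z| * (1 + Real.log (1 + z ^ 2)) ^ (-(1 + γ)) := by
  set G : ℝ → ℝ := fun v => v ^ (-(3 / 2) : ℝ) * exp (-(1 / (4 * v))) with hG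
  set K : ℝ := γ * ((4 * (1 + γ)) ^ (1 + γ) * exp (1 / 4)) with hK
  have hK0 : 0 < K := by positivity
  have hI : 0 ≤ ∫ v in Ioi (0:ℝ), G v :=
    setIntegral_nonneg measurableSet_Ioi fun v hv => by
      have : 0 < v := hv
      positivity
  refine ⟨K * ((∫ v in Ioi (0:ℝ), G v) + 1), by positivity, fun z hz => ?_⟩
  have ha : 0 < |z| := abs_pos.mpr hz
  have hz2 : 0 < (z ^ 2)⁻¹ := by positivity
  have hs0 : 0 ≤ log (1 + z ^ 2) := log_nonneg (by nlinarith)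
  have hint : IntegrableOn (fun u => G ((z ^ 2)⁻¹ * u)) (Ioi 0) := by
    rw [integrableOn_Ioi_comp_mul_left_iff _ _ hz2, mul_zero]
    exact integrableOn_rpow_mul_exp_neg_inv
  calc f1 γ z
      ≤ ∫ u in Ioi (0:ℝ), K * (1 + log (1 + z ^ 2)) ^ (-(1 + γ)) * (|z| ^ 3)⁻¹ *
          G ((z ^ 2)⁻¹ * u) := by
        refine integral_mono_of_nonneg ?_ (hint.const_mul _) ?_
        · filter_upwards [ae_restrict_mem measurableSet_Ioi] with u hu
          exact normPdf_mul_Hdens_nonneg z hγ hu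
        · filter_upwards [ae_restrict_mem measurableSet_Ioi] with u hu
          exact normPdf_mul_Hdens_le hγ hz hu
    _ = K * (∫ v in Ioi (0:ℝ), G v) / |z| * (1 + log (1 + z ^ 2)) ^ (-(1 + γ)) := by
        rw [integral_const_mul, integral_comp_mul_left_Ioi _ _ hz2, mul_zero, smul_eq_mul,
          inv_inv, ← sq_abs z]
        field_simp
    _ ≤ _ := by
        gcongr
        linarith
end

section
/- There exists a constant C₂ > 0 such that for all z ∈ ℝ with |z| ≥ 1, f₁(z) ≥ (C₂/|z|)·(1 + log(1+z²))^{-(1+γ)}. -/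
open MeasureTheory Real Filter Set

lemma normPdf_nonneg (z u : ℝ) : 0 ≤ normPdf z u := by
  unfold normPdf
  positivity

lemma Hdens_nonneg {γ u : ℝ} (hγ : 0 ≤ γ) (hu : 0 ≤ u) : 0 ≤ Hdens γ u := by
  have := Real.log_nonneg (show 1 ≤ 1 + u by linarith)
  unfold Hdens
  positivity

lemma normPdf_le_rpow (z : ℝ) {u : ℝ} (hu : 0 < u) : normPdf z u ≤ u ^ (-(1 / 2) : ℝ) := by
  have hsqrt : Real.sqrt u ≤ Real.sqrt (2 * Real.pi * u) := by
    apply Real.sqrt_le_sqrt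
    nlinarith [Real.pi_gt_three]
  have hexp : Real.exp (-(z ^ 2) / (2 * u)) ≤ 1 := by
    rw [Real.exp_le_one_iff, neg_div, neg_nonpos]
    positivity
  have hpos : 0 < Real.sqrt u := Real.sqrt_pos.2 hu
  rw [Real.rpow_neg hu.le, ← Real.sqrt_eq_rpow]
  calc normPdf z u ≤ (Real.sqrt (2 * Real.pi * u))⁻¹ * 1 := by
        unfold normPdf
        gcongr
    _ ≤ (Real.sqrt u)⁻¹ := by
        rw [mul_one]
        gcongr

lemma Hdens_le {γ u : ℝ} (hγ : 0 ≤ γ) (hu : 0 ≤ u) : Hdens γ u ≤ γ / (1 + u) := by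
  have hlog := Real.log_nonneg (show 1 ≤ 1 + u by linarith)
  have hpow : 1 ≤ (1 + Real.log (1 + u)) ^ (1 + γ) :=
    Real.one_le_rpow (by linarith) (by linarith)
  unfold Hdens
  gcongr
  nlinarith

lemma measurable_normPdf_mul_Hdens (γ z : ℝ) :
    Measurable fun u => normPdf z u * Hdens γ u := by
  unfold normPdf Hdens
  fun_prop

lemma integrableOn_normPdf_mul_Hdens {γ : ℝ} (hγ : 0 ≤ γ) (z : ℝ) :
    IntegrableOn (fun u => normPdf z u * Hdens γ u) (Set.Ioi 0) := by
  have hmeas := (measurable_normPdf_mul_Hdens γ z).aestronglyMeasurable (μ := volume)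
  rw [← Set.Ioc_union_Ioi_eq_Ioi (zero_le_one' ℝ)]
  refine IntegrableOn.union ?_ ?_
  · have hintegrable : IntegrableOn (fun u : ℝ => u ^ (-(1 / 2) : ℝ) * γ) (Set.Ioc 0 1) :=
      ((intervalIntegrable_iff_integrableOn_Ioc_of_le zero_le_one).1
        (intervalIntegral.intervalIntegrable_rpow' (by norm_num))).mul_const γ
    refine Integrable.mono' hintegrable hmeas.restrict ?_
    filter_upwards [ae_restrict_mem measurableSet_Ioc] with u hu
    have hu0 : 0 < u := hu.1
    have hH := Hdens_nonneg hγ hu0.le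
    rw [Real.norm_of_nonneg (mul_nonneg (normPdf_nonneg z u) hH)]
    have hHle : Hdens γ u ≤ γ :=
      (Hdens_le hγ hu0.le).trans (div_le_self hγ (by linarith))
    gcongr
    exact normPdf_le_rpow z hu0
  · have hintegrable : IntegrableOn (fun u : ℝ => u ^ (-(3 / 2) : ℝ) * γ) (Set.Ioi 1) :=
      (integrableOn_Ioi_rpow_of_lt (by norm_num) one_pos).mul_const γ
    refine Integrable.mono' hintegrable hmeas.restrict ?_
    filter_upwards [ae_restrict_mem measurableSet_Ioi] with u hu
    have hu0 : 0 < u := one_pos.trans hu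
    have hH := Hdens_nonneg hγ hu0.le
    rw [Real.norm_of_nonneg (mul_nonneg (normPdf_nonneg z u) hH)]
    have hHle : Hdens γ u ≤ γ / u := by
      refine (Hdens_le hγ hu0.le).trans ?_
      gcongr
      linarith
    have hsplit : u ^ (-(3 / 2) : ℝ) * γ = u ^ (-(1 / 2) : ℝ) * (γ / u) := by
      rw [show (-(3 / 2) : ℝ) = -(1 / 2) - 1 by norm_num, Real.rpow_sub_one hu0.ne']
      ring
    rw [hsplit]
    gcongr
    exact normPdf_le_rpow z hu0

lemma le_normPdf {z u : ℝ} (hz : z ≠ 0) (hu : u ∈ Set.Ioc (z ^ 2 / 2) (z ^ 2)) :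
    (Real.sqrt (2 * Real.pi) * |z|)⁻¹ * Real.exp (-1) ≤ normPdf z u := by
  have hz2 : 0 < z ^ 2 := by positivity
  have hu0 : 0 < u := lt_trans (by positivity) hu.1
  have hsqrt : Real.sqrt (2 * Real.pi * u) ≤ Real.sqrt (2 * Real.pi) * |z| := by
    rw [Real.sqrt_mul (by positivity), ← Real.sqrt_sq_eq_abs]
    gcongr
    exact hu.2
  have hexp : -1 ≤ -(z ^ 2) / (2 * u) := by
    rw [le_div_iff₀ (by positivity)]
    linarith [hu.1]
  unfold normPdf
  gcongr

lemma Hdens_le_Hdens_of_le {γ u v : ℝ} (hγ : 0 ≤ γ) (hu : 0 ≤ u) (huv : u ≤ v) :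
    Hdens γ v ≤ Hdens γ u := by
  have hlog := Real.log_nonneg (show 1 ≤ 1 + u by linarith)
  have hv : 0 ≤ 1 + v := by linarith
  unfold Hdens
  gcongr

/-- There is `C₂ > 0` such that for all `z` with `|z| ≥ 1`,
`f₁(z) ≥ (C₂/|z|)·(1+log(1+z²))^{-(1+γ)}`. -/
theorem f1_lower_bound (γ : ℝ) (hγ : 0 < γ) :
    ∃ C₂ > (0:ℝ), ∀ z : ℝ, 1 ≤ |z| →
      C₂ / |z| * (1 + Real.log (1 + z ^ 2)) ^ (-(1 + γ)) ≤ f1 γ z := by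
  refine ⟨γ * Real.exp (-1) / (4 * Real.sqrt (2 * Real.pi)), by positivity, fun z hz => ?_⟩
  have hz0 : z ≠ 0 := abs_pos.1 (one_pos.trans_le hz)
  have hz1 : 1 ≤ z ^ 2 := (one_le_sq_iff_one_le_abs z).2 hz
  have hlog := Real.log_nonneg (show 1 ≤ 1 + z ^ 2 by linarith)
  have hintegrable := integrableOn_normPdf_mul_Hdens hγ.le z
  have hsub : Set.Ioc (z ^ 2 / 2) (z ^ 2) ⊆ Set.Ioi 0 := fun u hu =>
    lt_trans (by positivity) hu.1
  have hpow : 0 < (1 + Real.log (1 + z ^ 2)) ^ (1 + γ) := by positivity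
  set L := (1 + Real.log (1 + z ^ 2)) ^ (1 + γ) with hL
  have hH : γ / (2 * z ^ 2 * L) ≤ Hdens γ (z ^ 2) := by
    unfold Hdens
    rw [← hL]
    gcongr
    linarith
  have hconst := setIntegral_ge_of_const_le_real (μ := volume)
    (c := (Real.sqrt (2 * Real.pi) * |z|)⁻¹ * Real.exp (-1) * (γ / (2 * z ^ 2 * L)))
    measurableSet_Ioc (by simp)
    (fun u hu => mul_le_mul (le_normPdf hz0 hu)
      (hH.trans (Hdens_le_Hdens_of_le hγ.le (le_of_lt (hsub hu)) hu.2)) (by positivity)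
      (normPdf_nonneg z u)) (hintegrable.mono_set hsub)
  calc _ = (Real.sqrt (2 * Real.pi) * |z|)⁻¹ * Real.exp (-1) * (γ / (2 * z ^ 2 * L)) *
        volume.real (Set.Ioc (z ^ 2 / 2) (z ^ 2)) := by
        rw [Real.volume_real_Ioc_of_le (by linarith), Real.rpow_neg (by positivity), ← hL]
        have : |z| ≠ 0 := abs_ne_zero.2 hz0
        field_simp
        ring
    _ ≤ _ := hconst
    _ ≤ f1 γ z := by
        refine setIntegral_mono_set hintegrable ?_ hsub.eventuallyLE
        filter_upwards [ae_restrict_mem measurableSet_Ioi] with u hu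
        exact mul_nonneg (normPdf_nonneg z u) (Hdens_nonneg hγ.le (le_of_lt hu))
end
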